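/- arXiv:1011.1233 — 6 statements merged into one kernel-verified Lean document; each statement's English description precedes it below -/
import Mathlib

section
/- Let b be a nonnegative bilinear map and a ≥ 0. Suppose x > 0 (componentwise) satisfies x = a + b(x,x), and the matrix F'_x := I − b(x,·) − b(·,x) is invertible with entrywise nonnegative inverse. Then every nonnegative solution x̄ of x̄ = a + b(x̄,x̄) satisfies x ≤ x̄ componentwise; in particular x is the minimal nonnegative solution. -/
open Matrix

/-- A bilinear map with nonnegative coefficients is nonnegative on nonnegative vectors. -/
theorem bilin_nonneg {ι κ μ : Type*} [Fintype ι] [DecidableEq ι] [Fintype κ] [DecidableEq κ]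
    (b : (ι → ℝ) →ₗ[ℝ] (κ → ℝ) →ₗ[ℝ] (μ → ℝ))
    (hb : ∀ i j k, 0 ≤ b (Pi.single j 1) (Pi.single k 1) i)
    {u : ι → ℝ} {v : κ → ℝ} (hu : 0 ≤ u) (hv : 0 ≤ v) : 0 ≤ b u v := by
  intro i
  rw [pi_eq_sum_univ' u, pi_eq_sum_univ' v]
  simp only [map_sum, map_smul, LinearMap.sum_apply, LinearMap.smul_apply, Finset.sum_apply,
    Pi.smul_apply, smul_eq_mul, Pi.zero_apply]
  refine Finset.sum_nonneg fun k _ => mul_nonneg (hv k) (Finset.sum_nonneg fun j _ =>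
    mul_nonneg (hu j) ?_)
  convert hb i j k using 3

/-- A bilinear map with nonnegative coefficients is monotone on nonnegative vectors. -/
theorem bilin_mono {ι κ μ : Type*} [Fintype ι] [DecidableEq ι] [Fintype κ] [DecidableEq κ]
    (b : (ι → ℝ) →ₗ[ℝ] (κ → ℝ) →ₗ[ℝ] (μ → ℝ))
    (hb : ∀ i j k, 0 ≤ b (Pi.single j 1) (Pi.single k 1) i)
    {u u' : ι → ℝ} {v v' : κ → ℝ} (hu : 0 ≤ u) (hv' : 0 ≤ v') (huu' : u ≤ u') (hvv' : v ≤ v') :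
    b u v ≤ b u' v' := by
  have h₁ := bilin_nonneg b hb hu (sub_nonneg.2 hvv')
  have h₂ := bilin_nonneg b hb (sub_nonneg.2 huu') hv'
  simp only [map_sub, LinearMap.sub_apply, sub_nonneg] at h₁ h₂
  exact h₁.trans h₂

/-- a positive solution whose Jacobian `F'_x = I - b(x,·) - b(·,x)`
is invertible with entrywise nonnegative inverse is below every nonnegative
solution, hence is the minimal nonnegative solution. -/
theorem stmt_1 {N : ℕ} (hN : 1 ≤ N)
    (b : (Fin N → ℝ) →ₗ[ℝ] (Fin N → ℝ) →ₗ[ℝ] (Fin N → ℝ))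
    (hb : ∀ i j k : Fin N, 0 ≤ b (Pi.single j 1) (Pi.single k 1) i)
    (a : Fin N → ℝ) (ha : 0 ≤ a)
    (x : Fin N → ℝ) (hx : ∀ i, 0 < x i)
    (hsol : x = a + b x x)
    (S : Matrix (Fin N) (Fin N) ℝ)
    (hS1 : ((1 : Matrix (Fin N) (Fin N) ℝ)
        - LinearMap.toMatrix' (b x) - LinearMap.toMatrix' (b.flip x)) * S = 1)
    (hS2 : S * ((1 : Matrix (Fin N) (Fin N) ℝ)
        - LinearMap.toMatrix' (b x) - LinearMap.toMatrix' (b.flip x)) = 1)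
    (hSnn : ∀ i j, 0 ≤ S i j) :
    ∀ xbar : Fin N → ℝ, 0 ≤ xbar → xbar = a + b xbar xbar → x ≤ xbar := by
  intro y hy hysol
  -- The infimum `z` of `x` and `y` is a supersolution below `x`.
  set z := x ⊓ y with hz
  have hz0 : 0 ≤ z := le_inf (fun i => (hx i).le) hy
  have hzx : z ≤ x := inf_le_left
  have hzy : z ≤ y := inf_le_right
  have hsuper : a + b z z ≤ z := by
    refine le_inf ?_ ?_
    · conv_rhs => rw [hsol]
      exact add_le_add_right (bilin_mono b hb hz0 (hz0.trans hzx) hzx hzx) a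
    · conv_rhs => rw [hysol]
      exact add_le_add_right (bilin_mono b hb hz0 hy hzy hzy) a
  have hquad : 0 ≤ b (x - z) (x - z) :=
    bilin_nonneg b hb (sub_nonneg.2 hzx) (sub_nonneg.2 hzx)
  have hF : 0 ≤ ((1 : Matrix (Fin N) (Fin N) ℝ)
      - LinearMap.toMatrix' (b x) - LinearMap.toMatrix' (b.flip x)) *ᵥ (z - x) := by
    intro i
    have h₁ := hsuper i
    have h₂ := hquad i
    have h₃ := congrFun hsol i
    simp only [sub_mulVec, one_mulVec, LinearMap.toMatrix'_mulVec, map_sub, LinearMap.sub_apply,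
      LinearMap.flip_apply, Pi.add_apply, Pi.sub_apply, Pi.zero_apply] at h₁ h₂ h₃ ⊢
    linarith
  have hzx' : 0 ≤ z - x := by
    rw [← one_mulVec (z - x), ← hS2, ← mulVec_mulVec]
    exact fun i => dotProduct_nonneg_of_nonneg (hSnn i) hF
  exact (sub_nonneg.1 hzx').trans hzy
end

section
/- Let b be a nonnegative bilinear map on ℝ^N and 1 ≤ M < N. Suppose R_{ij} = 0 for all i > M and all j ≤ M, where R_{ij} = Σ_k (b_{ijk} + b_{ikj}). Then b_{ijk} = 0 whenever i > M and (j ≤ M or k ≤ M). Consequently, for all u, v ∈ ℝ^N, the last N−M components of b(u,v) depend only on the last N−M components of u and v; formally, Q b(u,v) = Q b(Q^T Q u, Q^T Q v), where Q := [0_{(N−M)×M} I_{N−M}]. -/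
open Matrix

/-- The projection `Q = [0 I]` onto the last `K` of `M + K` coordinates. -/
def Qmat (M K : ℕ) : Matrix (Fin K) (Fin (M + K)) ℝ :=
  Matrix.of fun i j => if (j : ℕ) = M + (i : ℕ) then 1 else 0

theorem Qmat_mulVec {M K : ℕ} (w : Fin (M + K) → ℝ) (i : Fin K) :
    (Qmat M K).mulVec w i = w (Fin.natAdd M i) := by
  have h (j : Fin (M + K)) : (j : ℕ) = M + (i : ℕ) ↔ j = Fin.natAdd M i := by
    simp [Fin.ext_iff]
  simp [Matrix.mulVec, dotProduct, Qmat, h]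

theorem Qmat_transpose_mulVec_natAdd {M K : ℕ} (w : Fin K → ℝ) (j : Fin K) :
    (Qmat M K)ᵀ.mulVec w (Fin.natAdd M j) = w j := by
  simp [Matrix.mulVec, dotProduct, Qmat, ← Fin.ext_iff]

theorem apply_apply_eq_sum_single {ι : Type*} [Fintype ι] [DecidableEq ι]
    (b : (ι → ℝ) →ₗ[ℝ] (ι → ℝ) →ₗ[ℝ] (ι → ℝ)) (u v : ι → ℝ) (i : ι) :
    b u v i = ∑ j, ∑ k, u j * (v k * b (Pi.single j 1) (Pi.single k 1) i) := by
  conv_lhs => rw [pi_eq_sum_univ' u, pi_eq_sum_univ' v]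
  simp only [map_sum, map_smul, LinearMap.sum_apply, LinearMap.smul_apply, Finset.sum_apply,
    Pi.smul_apply, smul_eq_mul, Finset.mul_sum]
  rw [Finset.sum_comm]
  exact Finset.sum_congr rfl fun _ _ => Finset.sum_congr rfl fun _ _ => mul_left_comm _ _ _

/-- if `R_{ij} = 0` for `i` in the last block and `j` in the first
block, then `b_{ijk} = 0` whenever `i` is in the last block and `j` or `k` is in
the first block; consequently `Q b(u,v) = Q b(QᵀQu, QᵀQv)` for all `u, v`.
(Here the dimension is `N = M + K` with `M ≥ 1`, `K = N - M ≥ 1`.) -/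
theorem stmt_4 {M K : ℕ} (hM : 1 ≤ M) (hK : 1 ≤ K)
    (b : (Fin (M + K) → ℝ) →ₗ[ℝ] (Fin (M + K) → ℝ) →ₗ[ℝ] (Fin (M + K) → ℝ))
    (hb : ∀ i j k : Fin (M + K), 0 ≤ b (Pi.single j 1) (Pi.single k 1) i)
    (hR : ∀ i j : Fin (M + K), M ≤ (i : ℕ) → (j : ℕ) < M →
      ∑ k, (b (Pi.single j 1) (Pi.single k 1) i + b (Pi.single k 1) (Pi.single j 1) i) = 0) :
    (∀ i j k : Fin (M + K), M ≤ (i : ℕ) → ((j : ℕ) < M ∨ (k : ℕ) < M) →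
        b (Pi.single j 1) (Pi.single k 1) i = 0)
    ∧ ∀ u v : Fin (M + K) → ℝ,
        (Qmat M K).mulVec (b u v)
          = (Qmat M K).mulVec
              (b ((Qmat M K)ᵀ.mulVec ((Qmat M K).mulVec u))
                 ((Qmat M K)ᵀ.mulVec ((Qmat M K).mulVec v))) := by
  have hzero : ∀ i j k : Fin (M + K), M ≤ (i : ℕ) → (j : ℕ) < M →
      b (Pi.single j 1) (Pi.single k 1) i = 0 ∧ b (Pi.single k 1) (Pi.single j 1) i = 0 := by
    intro i j k hi hj
    have hsum := (Finset.sum_eq_zero_iff_of_nonneg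
      fun k _ => add_nonneg (hb i j k) (hb i k j)).1 (hR i j hi hj) k (Finset.mem_univ k)
    exact (add_eq_zero_iff_of_nonneg (hb i j k) (hb i k j)).1 hsum
  have hvanish : ∀ i j k : Fin (M + K), M ≤ (i : ℕ) → ((j : ℕ) < M ∨ (k : ℕ) < M) →
      b (Pi.single j 1) (Pi.single k 1) i = 0 := by
    rintro i j k hi (hj | hk)
    · exact (hzero i j k hi hj).1
    · exact (hzero i k j hi hk).2
  refine ⟨hvanish, fun u v => funext fun i => ?_⟩
  rw [Qmat_mulVec, Qmat_mulVec, apply_apply_eq_sum_single b u v,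
    apply_apply_eq_sum_single b ((Qmat M K)ᵀ.mulVec _)]
  refine Finset.sum_congr rfl fun j _ => Finset.sum_congr rfl fun k _ => ?_
  by_cases hjk : (j : ℕ) < M ∨ (k : ℕ) < M
  · simp [hvanish (Fin.natAdd M i) j k (by simp) hjk]
  · push Not at hjk
    obtain ⟨j, rfl⟩ : ∃ l, Fin.natAdd M l = j :=
      ⟨Fin.subNat M (j.cast (Nat.add_comm M K)) hjk.1, by simp⟩
    obtain ⟨k, rfl⟩ : ∃ l, Fin.natAdd M l = k :=
      ⟨Fin.subNat M (k.cast (Nat.add_comm M K)) hjk.2, by simp⟩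
    simp only [Qmat_transpose_mulVec_natAdd, Qmat_mulVec]
end

section
/- Consider a QVE x = a + b(x,x) with nonnegative bilinear b, a ≥ 0, a + b(e,e) = e, whose minimal nonnegative solution x* = (x1*; x2*) is strictly positive, and suppose R_{ij} = 0 for all i > M and j ≤ M. Then x2* is the minimal nonnegative solution of the QVE x2 = a2 + b2(x2,x2) on ℝ^{N−M}, and x1* is the minimal nonnegative solution of the QVE x1 = a_{x2*} + b_{x2*}(x1,x1) on ℝ^M. -/
open Matrix

/-- The projection `P = [I 0]` onto the first `M` of `M + K` coordinates. -/
def Pmat (M K : ℕ) : Matrix (Fin M) (Fin (M + K)) ℝ :=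
  Matrix.of fun i j => if (j : ℕ) = (i : ℕ) then 1 else 0

/-- `T_y := I_M - P b(·, Qᵀy) Pᵀ - P b(Qᵀy, ·) Pᵀ`. -/
noncomputable def Tmat (M K : ℕ)
    (b : (Fin (M + K) → ℝ) →ₗ[ℝ] (Fin (M + K) → ℝ) →ₗ[ℝ] (Fin (M + K) → ℝ))
    (y : Fin K → ℝ) : Matrix (Fin M) (Fin M) ℝ :=
  1 - Pmat M K * LinearMap.toMatrix' (b.flip ((Qmat M K)ᵀ.mulVec y)) * (Pmat M K)ᵀ
    - Pmat M K * LinearMap.toMatrix' (b ((Qmat M K)ᵀ.mulVec y)) * (Pmat M K)ᵀ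

/-- `b_2(u,v) := Q b(Qᵀu, Qᵀv)`. -/
def b2 (M K : ℕ)
    (b : (Fin (M + K) → ℝ) →ₗ[ℝ] (Fin (M + K) → ℝ) →ₗ[ℝ] (Fin (M + K) → ℝ))
    (u v : Fin K → ℝ) : Fin K → ℝ :=
  (Qmat M K).mulVec (b ((Qmat M K)ᵀ.mulVec u) ((Qmat M K)ᵀ.mulVec v))

/-- `a_y := T_y⁻¹ (a_1 + P b(Qᵀy, Qᵀy))` where `a_1 = P a`. -/
noncomputable def aSub (M K : ℕ)
    (b : (Fin (M + K) → ℝ) →ₗ[ℝ] (Fin (M + K) → ℝ) →ₗ[ℝ] (Fin (M + K) → ℝ))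
    (a : Fin (M + K) → ℝ) (y : Fin K → ℝ) : Fin M → ℝ :=
  (Tmat M K b y)⁻¹.mulVec
    ((Pmat M K).mulVec a
      + (Pmat M K).mulVec (b ((Qmat M K)ᵀ.mulVec y) ((Qmat M K)ᵀ.mulVec y)))

/-- `b_y(u,v) := T_y⁻¹ P b(Pᵀu, Pᵀv)`. -/
noncomputable def bSub (M K : ℕ)
    (b : (Fin (M + K) → ℝ) →ₗ[ℝ] (Fin (M + K) → ℝ) →ₗ[ℝ] (Fin (M + K) → ℝ))
    (y : Fin K → ℝ) (u v : Fin M → ℝ) : Fin M → ℝ :=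
  (Tmat M K b y)⁻¹.mulVec
    ((Pmat M K).mulVec (b ((Pmat M K)ᵀ.mulVec u) ((Pmat M K)ᵀ.mulVec v)))

lemma Pmat_mulVec_apply {M K : ℕ} (x : Fin (M + K) → ℝ) (i : Fin M) :
    (Pmat M K).mulVec x i = x (Fin.castAdd K i) := by
  have h : ∀ j : Fin (M + K), ((j : ℕ) = i) ↔ j = Fin.castAdd K i := fun j => by simp [Fin.ext_iff]
  simp [Matrix.mulVec, dotProduct, Pmat, h]

lemma Qmat_mulVec_apply {M K : ℕ} (x : Fin (M + K) → ℝ) (i : Fin K) :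
    (Qmat M K).mulVec x i = x (Fin.natAdd M i) := by
  have h : ∀ j : Fin (M + K), ((j : ℕ) = M + i) ↔ j = Fin.natAdd M i := fun j => by
    simp [Fin.ext_iff]
  simp [Matrix.mulVec, dotProduct, Qmat, h]

lemma Pmat_transpose_mulVec {M K : ℕ} (z : Fin M → ℝ) :
    (Pmat M K)ᵀ.mulVec z = Fin.append z 0 := by
  ext i
  refine Fin.addCases (fun i => ?_) (fun i => ?_) i
  · simp [Matrix.mulVec, dotProduct, Pmat, ← Fin.ext_iff]
  · have h : ∀ j : Fin M, M + (i : ℕ) ≠ j := fun j => by omega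
    simp [Matrix.mulVec, dotProduct, Pmat, h]

lemma Qmat_transpose_mulVec {M K : ℕ} (y : Fin K → ℝ) :
    (Qmat M K)ᵀ.mulVec y = Fin.append 0 y := by
  ext i
  refine Fin.addCases (fun i => ?_) (fun i => ?_) i
  · have h : ∀ j : Fin K, (i : ℕ) ≠ M + j := fun j => by omega
    simp [Matrix.mulVec, dotProduct, Qmat, h]
  · simp [Matrix.mulVec, dotProduct, Qmat, ← Fin.ext_iff]

lemma append_zero_add_zero_append {M K : ℕ} (z : Fin M → ℝ) (y : Fin K → ℝ) :
    Fin.append z (0 : Fin K → ℝ) + Fin.append (0 : Fin M → ℝ) y = Fin.append z y := by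
  ext i
  refine Fin.addCases (fun i => ?_) (fun i => ?_) i <;> simp

lemma append_mono {M K : ℕ} {z z' : Fin M → ℝ} {y y' : Fin K → ℝ} (hz : z ≤ z') (hy : y ≤ y') :
    Fin.append z y ≤ Fin.append z' y' := by
  intro i
  refine Fin.addCases (fun i => ?_) (fun i => ?_) i
  · simpa using hz i
  · simpa using hy i

lemma append_nonneg {M K : ℕ} {z : Fin M → ℝ} {y : Fin K → ℝ} (hz : 0 ≤ z) (hy : 0 ≤ y) :
    0 ≤ Fin.append z y := by
  intro i
  refine Fin.addCases (fun i => ?_) (fun i => ?_) i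
  · simpa using hz i
  · simpa using hy i

lemma Tmat_mulVec_apply {M K : ℕ}
    (b : (Fin (M + K) → ℝ) →ₗ[ℝ] (Fin (M + K) → ℝ) →ₗ[ℝ] (Fin (M + K) → ℝ))
    (y : Fin K → ℝ) (z : Fin M → ℝ) (i : Fin M) :
    (Tmat M K b y).mulVec z i = z i
      - b (Fin.append z 0) (Fin.append 0 y) (Fin.castAdd K i)
      - b (Fin.append 0 y) (Fin.append z 0) (Fin.castAdd K i) := by
  simp only [Tmat, Matrix.sub_mulVec, ← Matrix.mulVec_mulVec, Matrix.one_mulVec, Pi.sub_apply,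
    Pmat_mulVec_apply, Pmat_transpose_mulVec, Qmat_transpose_mulVec,
    LinearMap.toMatrix'_mulVec, LinearMap.flip_apply]

section NonnegBilinear

variable {ι : Type*} [Fintype ι] [DecidableEq ι] {b : (ι → ℝ) →ₗ[ℝ] (ι → ℝ) →ₗ[ℝ] (ι → ℝ)}

lemma bilin_apply_eq_sum (b : (ι → ℝ) →ₗ[ℝ] (ι → ℝ) →ₗ[ℝ] (ι → ℝ)) (x y : ι → ℝ) (i : ι) :
    b x y i = ∑ j, ∑ k, x j * (y k * b (Pi.single j 1) (Pi.single k 1) i) := by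
  conv_lhs => rw [pi_eq_sum_univ' x, pi_eq_sum_univ' y]
  simp only [map_sum, map_smul, LinearMap.sum_apply, LinearMap.smul_apply, Finset.sum_apply,
    Pi.smul_apply, smul_eq_mul, Finset.mul_sum]
  rw [Finset.sum_comm]
  exact Finset.sum_congr rfl fun j _ => Finset.sum_congr rfl fun k _ => by ring

lemma bilin_nonneg_s7 (hb : ∀ i j k, 0 ≤ b (Pi.single j 1) (Pi.single k 1) i)
    {x y : ι → ℝ} (hx : 0 ≤ x) (hy : 0 ≤ y) : 0 ≤ b x y := by
  intro i
  rw [bilin_apply_eq_sum]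
  exact Finset.sum_nonneg fun j _ => Finset.sum_nonneg fun k _ =>
    mul_nonneg (hx j) (mul_nonneg (hy k) (hb i j k))

lemma bilin_mono_s7 (hb : ∀ i j k, 0 ≤ b (Pi.single j 1) (Pi.single k 1) i)
    {x x' y y' : ι → ℝ} (hx : 0 ≤ x) (hxx' : x ≤ x') (hy : 0 ≤ y) (hyy' : y ≤ y') :
    b x y ≤ b x' y' := by
  have h1 := bilin_nonneg_s7 hb (sub_nonneg.2 hxx') hy
  have h2 := bilin_nonneg_s7 hb (hx.trans hxx') (sub_nonneg.2 hyy')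
  intro i
  have h1i := h1 i
  have h2i := h2 i
  simp only [map_sub, LinearMap.sub_apply, Pi.sub_apply, Pi.zero_apply] at h1i h2i
  linarith

/-- Below every nonnegative supersolution of a QVE lies a nonnegative solution. -/
lemma exists_solution_le_of_supersolution
    (hb : ∀ i j k, 0 ≤ b (Pi.single j 1) (Pi.single k 1) i) {a : ι → ℝ} (ha : 0 ≤ a)
    {u : ι → ℝ} (hu : 0 ≤ u) (hsup : a + b u u ≤ u) :
    ∃ x, 0 ≤ x ∧ x = a + b x x ∧ x ≤ u := by
  let D : Set (ι → ℝ) := {x | 0 ≤ x ∧ a + b x x ≤ x}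
  let m : ι → ℝ := fun i => sInf ((fun x => x i) '' D)
  have huD : u ∈ D := ⟨hu, hsup⟩
  have hle : ∀ x ∈ D, m ≤ x := fun x hx i =>
    csInf_le ⟨0, by rintro _ ⟨z, hz, rfl⟩; exact hz.1 i⟩ ⟨x, hx, rfl⟩
  have hge : ∀ l : ι → ℝ, (∀ x ∈ D, l ≤ x) → l ≤ m := fun l hl i =>
    le_csInf ⟨u i, u, huD, rfl⟩ (by rintro _ ⟨z, hz, rfl⟩; exact hl z hz i)
  have hm0 : 0 ≤ m := hge 0 fun x hx => hx.1
  have hmsup : a + b m m ≤ m := hge _ fun x hx =>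
    (add_le_add_right (bilin_mono_s7 hb hm0 (hle x hx) hm0 (hle x hx)) a).trans hx.2
  have hF0 : 0 ≤ a + b m m := add_nonneg ha (bilin_nonneg_s7 hb hm0 hm0)
  have hmD : a + b m m ∈ D :=
    ⟨hF0, add_le_add_right (bilin_mono_s7 hb hF0 hmsup hF0 hmsup) a⟩
  exact ⟨m, hm0, le_antisymm (hle _ hmD) hmsup, hle u huD⟩

end NonnegBilinear

/-- If `R` is block upper triangular, the last block of `b` depends only on the last block of
the arguments. -/
lemma bilin_natAdd_eq {M K : ℕ}
    {b : (Fin (M + K) → ℝ) →ₗ[ℝ] (Fin (M + K) → ℝ) →ₗ[ℝ] (Fin (M + K) → ℝ)}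
    (hb : ∀ i j k : Fin (M + K), 0 ≤ b (Pi.single j 1) (Pi.single k 1) i)
    (hR : ∀ i j : Fin (M + K), M ≤ (i : ℕ) → (j : ℕ) < M →
      ∑ k, (b (Pi.single j 1) (Pi.single k 1) i + b (Pi.single k 1) (Pi.single j 1) i) = 0)
    (z z' : Fin M → ℝ) (y : Fin K → ℝ) (i : Fin K) :
    b (Fin.append z y) (Fin.append z y) (Fin.natAdd M i)
      = b (Fin.append z' y) (Fin.append z' y) (Fin.natAdd M i) := by
  have h : ∀ (j : Fin M) (k : Fin (M + K)),
      b (Pi.single (Fin.castAdd K j) 1) (Pi.single k 1) (Fin.natAdd M i) = 0 ∧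
      b (Pi.single k 1) (Pi.single (Fin.castAdd K j) 1) (Fin.natAdd M i) = 0 := by
    intro j k
    have hs := (Finset.sum_eq_zero_iff_of_nonneg fun k _ =>
      add_nonneg (hb (Fin.natAdd M i) (Fin.castAdd K j) k)
        (hb (Fin.natAdd M i) k (Fin.castAdd K j))).1
      (hR (Fin.natAdd M i) (Fin.castAdd K j) (by simp) (by simp)) k (Finset.mem_univ k)
    exact (add_eq_zero_iff_of_nonneg (hb _ _ _) (hb _ _ _)).1 hs
  rw [bilin_apply_eq_sum, bilin_apply_eq_sum]
  simp [Fin.sum_univ_add, h]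

/-- At the minimal solution, assumed positive, the matrix `T` is nonsingular. -/
lemma isUnit_Tmat_det_of_minimal {M K : ℕ}
    {b : (Fin (M + K) → ℝ) →ₗ[ℝ] (Fin (M + K) → ℝ) →ₗ[ℝ] (Fin (M + K) → ℝ)}
    (hb : ∀ i j k : Fin (M + K), 0 ≤ b (Pi.single j 1) (Pi.single k 1) i)
    {a : Fin (M + K) → ℝ} {x1 : Fin M → ℝ} {x2 : Fin K → ℝ}
    (hx1 : ∀ i, 0 < x1 i) (hx2 : 0 ≤ x2)
    (hsol : Fin.append x1 x2 = a + b (Fin.append x1 x2) (Fin.append x1 x2))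
    (hmin : ∀ u, 0 ≤ u → a + b u u ≤ u → Fin.append x1 x2 ≤ u) :
    IsUnit (Tmat M K b x2).det := by
  have key : ∀ v, (Tmat M K b x2).mulVec v = 0 → v ≤ x1 → v ≤ 0 := by
    intro v hv hvx
    have hu0 : 0 ≤ (x1 - v) ⊓ x1 := le_inf (sub_nonneg.2 hvx) fun i => (hx1 i).le
    have hux : (x1 - v) ⊓ x1 ≤ x1 := inf_le_right
    have huw : (x1 - v) ⊓ x1 ≤ x1 - v := inf_le_left
    set u := (x1 - v) ⊓ x1
    have hU0 : 0 ≤ Fin.append u x2 := append_nonneg hu0 hx2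
    have hUx : Fin.append u x2 ≤ Fin.append x1 x2 := append_mono hux le_rfl
    have hsup : a + b (Fin.append u x2) (Fin.append u x2) ≤ Fin.append x1 x2 :=
      (add_le_add_right (bilin_mono_s7 hb hU0 hUx hU0 hUx) a).trans hsol.ge
    have hle := hmin (Fin.append u x2) hU0 fun i => by
      refine Fin.addCases (fun i => ?_) (fun i => ?_) i
      · rw [Fin.append_left]
        refine le_inf ?_ ?_
        · have hP0 : 0 ≤ Fin.append u (0 : Fin K → ℝ) := append_nonneg hu0 le_rfl
          have hPx : Fin.append u (0 : Fin K → ℝ) ≤ Fin.append x1 0 := append_mono hux le_rfl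
          have hPw : Fin.append u (0 : Fin K → ℝ) ≤ Fin.append x1 0 - Fin.append v 0 := by
            intro j
            refine Fin.addCases (fun j => ?_) (fun j => ?_) j
            · simpa using huw j
            · simp
          have hQ0 : 0 ≤ Fin.append (0 : Fin M → ℝ) x2 := append_nonneg le_rfl hx2
          have h1 := bilin_mono_s7 hb hP0 hPx hP0 hPx (Fin.castAdd K i)
          have h2 := bilin_mono_s7 hb hP0 hPw hQ0 le_rfl (Fin.castAdd K i)
          have h3 := bilin_mono_s7 hb hQ0 le_rfl hP0 hPw (Fin.castAdd K i)
          have h4 := congrFun hv i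
          have h5 := congrFun hsol (Fin.castAdd K i)
          rw [Tmat_mulVec_apply] at h4
          rw [Fin.append_left] at h5
          rw [← append_zero_add_zero_append] at h5 ⊢
          simp only [map_sub, map_add, LinearMap.sub_apply, LinearMap.add_apply, Pi.sub_apply,
            Pi.add_apply, Pi.zero_apply] at h1 h2 h3 h4 h5 ⊢
          linarith
        · simpa using hsup (Fin.castAdd K i)
      · simpa using hsup (Fin.natAdd M i)
    intro i
    have h := (hle (Fin.castAdd K i))
    rw [Fin.append_left, Fin.append_left] at h
    have h' := h.trans (huw i)
    simp only [Pi.sub_apply, Pi.zero_apply] at h' ⊢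
    linarith
  have nonpos : ∀ v, (Tmat M K b x2).mulVec v = 0 → v ≤ 0 := by
    intro v hv
    have hev : ∀ᶠ ε : ℝ in nhdsWithin 0 (Set.Ioi 0), ∀ i, ε * v i < x1 i := by
      refine Filter.eventually_all.2 fun i => ?_
      have hc : Filter.Tendsto (fun ε : ℝ => ε * v i) (nhdsWithin 0 (Set.Ioi 0)) (nhds (0 * v i)) :=
        ((continuous_id.mul continuous_const).tendsto 0).mono_left nhdsWithin_le_nhds
      exact hc.eventually_lt_const (by simpa using hx1 i)
    obtain ⟨ε, hε, hpos⟩ := (hev.and self_mem_nhdsWithin).exists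
    have h := key (ε • v) (by rw [Matrix.mulVec_smul, hv, smul_zero]) fun i => (hε i).le
    intro i
    have hi := h i
    simp only [Pi.smul_apply, smul_eq_mul, Pi.zero_apply] at hi ⊢
    exact nonpos_of_mul_nonpos_right hi hpos
  rw [isUnit_iff_ne_zero]
  intro hdet
  obtain ⟨v, hv0, hv⟩ := Matrix.exists_mulVec_eq_zero_iff.2 hdet
  refine hv0 (le_antisymm (nonpos v hv) ?_)
  exact neg_nonpos.1 (nonpos (-v) (by rw [Matrix.mulVec_neg, hv, neg_zero]))

/-- For nonsingular `T`, the reduced equation is the first block of the QVE. -/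
lemma eq_aSub_add_bSub_iff {M K : ℕ}
    {b : (Fin (M + K) → ℝ) →ₗ[ℝ] (Fin (M + K) → ℝ) →ₗ[ℝ] (Fin (M + K) → ℝ)}
    {a : Fin (M + K) → ℝ} {y : Fin K → ℝ} (hT : IsUnit (Tmat M K b y).det) (z : Fin M → ℝ) :
    z = aSub M K b a y + bSub M K b y z z ↔
      ∀ i, z i = (a + b (Fin.append z y) (Fin.append z y)) (Fin.castAdd K i) := by
  rw [aSub, bSub, ← Matrix.mulVec_add]
  set c := (Pmat M K).mulVec a
      + (Pmat M K).mulVec (b ((Qmat M K)ᵀ.mulVec y) ((Qmat M K)ᵀ.mulVec y))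
      + (Pmat M K).mulVec (b ((Pmat M K)ᵀ.mulVec z) ((Pmat M K)ᵀ.mulVec z)) with hc
  have h1 : z = (Tmat M K b y)⁻¹.mulVec c ↔ (Tmat M K b y).mulVec z = c := by
    constructor
    · intro h
      rw [h, Matrix.mulVec_mulVec, Matrix.mul_nonsing_inv _ hT, Matrix.one_mulVec]
    · intro h
      rw [← h, Matrix.mulVec_mulVec, Matrix.nonsing_inv_mul _ hT, Matrix.one_mulVec]
  rw [h1, funext_iff]
  refine forall_congr' fun i => ?_
  rw [Tmat_mulVec_apply, hc, ← append_zero_add_zero_append z y]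
  simp only [Pmat_mulVec_apply, Pmat_transpose_mulVec, Qmat_transpose_mulVec, map_add,
    LinearMap.add_apply, Pi.add_apply]
  constructor <;> intro h <;> linarith

/-- if the minimal nonnegative solution `x* = (x₁*; x₂*)` of the
QVE is strictly positive and `R` is block upper triangular, then `x₂*` is the
minimal nonnegative solution of the reduced QVE `x₂ = a₂ + b₂(x₂,x₂)` and
`x₁*` is the minimal nonnegative solution of `x₁ = a_{x₂*} + b_{x₂*}(x₁,x₁)`. -/
theorem stmt_7 {M K : ℕ} (hM : 1 ≤ M) (hK : 1 ≤ K)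
    (b : (Fin (M + K) → ℝ) →ₗ[ℝ] (Fin (M + K) → ℝ) →ₗ[ℝ] (Fin (M + K) → ℝ))
    (hb : ∀ i j k : Fin (M + K), 0 ≤ b (Pi.single j 1) (Pi.single k 1) i)
    (a : Fin (M + K) → ℝ) (ha : 0 ≤ a)
    (he : a + b (fun _ => 1) (fun _ => 1) = fun _ => 1)
    (hR : ∀ i j : Fin (M + K), M ≤ (i : ℕ) → (j : ℕ) < M →
      ∑ k, (b (Pi.single j 1) (Pi.single k 1) i + b (Pi.single k 1) (Pi.single j 1) i) = 0)
    (xstar : Fin (M + K) → ℝ) (hxstar_pos : ∀ i, 0 < xstar i)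
    (hxstar_sol : xstar = a + b xstar xstar)
    (hxstar_min : ∀ xbar : Fin (M + K) → ℝ, 0 ≤ xbar → xbar = a + b xbar xbar → xstar ≤ xbar)
    (x1star : Fin M → ℝ) (hx1 : x1star = (Pmat M K).mulVec xstar)
    (x2star : Fin K → ℝ) (hx2 : x2star = (Qmat M K).mulVec xstar) :
    (0 ≤ x2star ∧ x2star = (Qmat M K).mulVec a + b2 M K b x2star x2star ∧
      ∀ y : Fin K → ℝ, 0 ≤ y → y = (Qmat M K).mulVec a + b2 M K b y y → x2star ≤ y)
    ∧ (0 ≤ x1star ∧ x1star = aSub M K b a x2star + bSub M K b x2star x1star x1star ∧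
      ∀ z : Fin M → ℝ, 0 ≤ z → z = aSub M K b a x2star + bSub M K b x2star z z → x1star ≤ z) := by
  have hsup : ∀ u, 0 ≤ u → a + b u u ≤ u → xstar ≤ u := fun u hu h => by
    obtain ⟨x, hx0, hx, hxu⟩ := exists_solution_le_of_supersolution hb ha hu h
    exact (hxstar_min x hx0 hx).trans hxu
  have hx : xstar = Fin.append x1star x2star := by
    ext i
    refine Fin.addCases (fun i => ?_) (fun i => ?_) i
    · rw [Fin.append_left, hx1, Pmat_mulVec_apply]
    · rw [Fin.append_right, hx2, Qmat_mulVec_apply]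
  have hx1pos : ∀ i, 0 < x1star i := fun i => by
    rw [hx1, Pmat_mulVec_apply]
    exact hxstar_pos _
  have hx2pos : 0 ≤ x2star := fun i => by
    rw [hx2, Qmat_mulVec_apply]
    exact (hxstar_pos _).le
  clear hx1 hx2
  subst hx
  have hred : ∀ y : Fin K → ℝ, y = (Qmat M K).mulVec a + b2 M K b y y ↔
      ∀ (z : Fin M → ℝ) (i : Fin K),
        y i = (a + b (Fin.append z y) (Fin.append z y)) (Fin.natAdd M i) := fun y => by
    have h : ∀ (z : Fin M → ℝ) (i : Fin K), ((Qmat M K).mulVec a + b2 M K b y y) i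
        = (a + b (Fin.append z y) (Fin.append z y)) (Fin.natAdd M i) := fun z i => by
      rw [Pi.add_apply, Pi.add_apply, b2, Qmat_mulVec_apply, Qmat_mulVec_apply,
        Qmat_transpose_mulVec, bilin_natAdd_eq hb hR 0 z]
    exact ⟨fun hy z i => (congrFun hy i).trans (h z i),
      fun hy => funext fun i => (hy 0 i).trans (h 0 i).symm⟩
  have hT := isUnit_Tmat_det_of_minimal hb hx1pos hx2pos hxstar_sol hsup
  have hx2sol : x2star = (Qmat M K).mulVec a + b2 M K b x2star x2star := by
    refine (hred _).2 fun z i => ?_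
    rw [Pi.add_apply, bilin_natAdd_eq hb hR z x1star]
    simpa using congrFun hxstar_sol (Fin.natAdd M i)
  refine ⟨⟨hx2pos, hx2sol, fun y hy0 hy => ?_⟩, fun i => (hx1pos i).le, ?_, fun z hz0 hz => ?_⟩
  · have hu0 : 0 ≤ y ⊓ 1 := le_inf hy0 zero_le_one
    have hU0 : 0 ≤ Fin.append (1 : Fin M → ℝ) (y ⊓ 1) := append_nonneg zero_le_one hu0
    have hUe : Fin.append (1 : Fin M → ℝ) (y ⊓ 1) ≤ fun _ => 1 := fun i => by
      refine Fin.addCases (fun i => ?_) (fun i => ?_) i <;> simp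
    have hFe : a + b (Fin.append 1 (y ⊓ 1)) (Fin.append 1 (y ⊓ 1)) ≤ fun _ => 1 :=
      (add_le_add_right (bilin_mono_s7 hb hU0 hUe hU0 hUe) a).trans he.le
    have hUy : Fin.append (1 : Fin M → ℝ) (y ⊓ 1) ≤ Fin.append 1 y :=
      append_mono le_rfl inf_le_left
    have hFy := add_le_add_right (bilin_mono_s7 hb hU0 hUy hU0 hUy) a
    have h := hsup (Fin.append 1 (y ⊓ 1)) hU0 fun i => by
      refine Fin.addCases (fun i => ?_) (fun i => ?_) i
      · simpa using hFe (Fin.castAdd K i)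
      · rw [Fin.append_right]
        exact le_inf ((hFy _).trans ((hred y).1 hy 1 i).ge) (hFe _)
    intro i
    have hi := h (Fin.natAdd M i)
    rw [Fin.append_right, Fin.append_right] at hi
    exact hi.trans inf_le_left
  · refine (eq_aSub_add_bSub_iff hT _).2 fun i => ?_
    rw [← hxstar_sol, Fin.append_left]
  · have h := hxstar_min (Fin.append z x2star) (append_nonneg hz0 hx2pos) <| funext fun i => by
      refine Fin.addCases (fun i => ?_) (fun i => ?_) i
      · rw [Fin.append_left]
        exact (eq_aSub_add_bSub_iff hT z).1 hz i
      · rw [Fin.append_right]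
        exact (hred _).1 hx2sol z i
    intro i
    simpa using h (Fin.castAdd K i)
end

section
/- Let b be a nonnegative bilinear map on ℝ^N, 1 ≤ M < N, and let y, y' ∈ ℝ^{N−M} with 0 ≤ y ≤ y'. Suppose the matrices T_y and T_{y'} are both invertible with entrywise nonnegative inverses. Then: (i) T_{y'} ≤ T_y entrywise; (ii) T_y^{-1} ≤ T_{y'}^{-1} entrywise; (iii) a_y ≤ a_{y'}; and (iv) b_y(u,v) ≤ b_{y'}(u,v) for all u, v ≥ 0 in ℝ^M. -/
open Matrix

section Nonneg

variable {l m n : Type*}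

lemma Matrix.mul_entry_nonneg [Fintype m] {A : Matrix l m ℝ} {B : Matrix m n ℝ}
    (hA : ∀ i j, 0 ≤ A i j) (hB : ∀ i j, 0 ≤ B i j) (i : l) (j : n) : 0 ≤ (A * B) i j := by
  rw [Matrix.mul_apply]
  exact Finset.sum_nonneg fun k _ => mul_nonneg (hA i k) (hB k j)

lemma Matrix.mulVec_le_mulVec_of_entry_nonneg [Fintype n] {A B : Matrix m n ℝ} {u v : n → ℝ}
    (hA : ∀ i j, 0 ≤ A i j) (hAB : ∀ i j, A i j ≤ B i j) (hv : 0 ≤ v) (huv : u ≤ v) :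
    A *ᵥ u ≤ B *ᵥ v := fun i =>
  Finset.sum_le_sum fun j _ =>
    (mul_le_mul_of_nonneg_left (huv j) (hA i j)).trans
      (mul_le_mul_of_nonneg_right (hAB i j) (hv j))

lemma Matrix.mulVec_nonneg_of_entry_nonneg [Fintype n] {A : Matrix m n ℝ} {v : n → ℝ}
    (hA : ∀ i j, 0 ≤ A i j) (hv : 0 ≤ v) : 0 ≤ A *ᵥ v := fun i =>
  Finset.sum_nonneg fun j _ => mul_nonneg (hA i j) (hv j)

/-- Inversion is antitone on matrices with entrywise nonnegative inverses. -/
lemma Matrix.inv_entry_le_inv [Fintype n] [DecidableEq n] {A B : Matrix n n ℝ}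
    (hA : IsUnit A) (hB : IsUnit B) (hA' : ∀ i j, 0 ≤ A⁻¹ i j) (hB' : ∀ i j, 0 ≤ B⁻¹ i j)
    (hBA : ∀ i j, B i j ≤ A i j) (i j : n) : A⁻¹ i j ≤ B⁻¹ i j := by
  have key : B⁻¹ - A⁻¹ = B⁻¹ * (A - B) * A⁻¹ := by
    rw [Matrix.mul_sub, Matrix.sub_mul, Matrix.mul_assoc,
      Matrix.mul_nonsing_inv A ((Matrix.isUnit_iff_isUnit_det A).1 hA),
      Matrix.nonsing_inv_mul B ((Matrix.isUnit_iff_isUnit_det B).1 hB),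
      Matrix.mul_one, Matrix.one_mul]
  have h : 0 ≤ (B⁻¹ - A⁻¹) i j := by
    rw [key]
    exact Matrix.mul_entry_nonneg
      (Matrix.mul_entry_nonneg hB' fun i j => sub_nonneg.2 (hBA i j)) hA' i j
  exact sub_nonneg.1 h

/-- A bilinear map with nonnegative coefficients is nonnegative on nonnegative vectors. -/
lemma LinearMap.apply_apply_nonneg_of_single [Fintype m] [DecidableEq m] [Fintype n]
    [DecidableEq n] {b : (m → ℝ) →ₗ[ℝ] (n → ℝ) →ₗ[ℝ] (l → ℝ)}
    (hb : ∀ i j k, 0 ≤ b (Pi.single j 1) (Pi.single k 1) i)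
    {u : m → ℝ} {v : n → ℝ} (hu : 0 ≤ u) (hv : 0 ≤ v) : 0 ≤ b u v := by
  intro i
  rw [pi_eq_sum_univ' u, pi_eq_sum_univ' v]
  simp only [map_sum, map_smul, LinearMap.sum_apply, LinearMap.smul_apply, Finset.sum_apply,
    Pi.smul_apply, smul_eq_mul, Pi.zero_apply]
  refine Finset.sum_nonneg fun j _ => ?_
  exact mul_nonneg (hv j) (Finset.sum_nonneg fun k _ => mul_nonneg (hu k) (hb i k j))

end Nonneg

lemma Pmat_nonneg (M K : ℕ) (i : Fin M) (j : Fin (M + K)) : 0 ≤ Pmat M K i j := by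
  simp only [Pmat, Matrix.of_apply]
  split_ifs <;> norm_num

lemma Qmat_nonneg (M K : ℕ) (i : Fin K) (j : Fin (M + K)) : 0 ≤ Qmat M K i j := by
  simp only [Qmat, Matrix.of_apply]
  split_ifs <;> norm_num

lemma Tmat_sub_Tmat (M K : ℕ)
    (b : (Fin (M + K) → ℝ) →ₗ[ℝ] (Fin (M + K) → ℝ) →ₗ[ℝ] (Fin (M + K) → ℝ))
    (y y' : Fin K → ℝ) :
    Tmat M K b y - Tmat M K b y' =
      Pmat M K * LinearMap.toMatrix' (b.flip ((Qmat M K)ᵀ *ᵥ (y' - y))) * (Pmat M K)ᵀ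
        + Pmat M K * LinearMap.toMatrix' (b ((Qmat M K)ᵀ *ᵥ (y' - y))) * (Pmat M K)ᵀ := by
  simp only [Tmat, Matrix.mulVec_sub, map_sub, Matrix.mul_sub, Matrix.sub_mul]
  abel

lemma Tmat_antitone {M K : ℕ}
    {b : (Fin (M + K) → ℝ) →ₗ[ℝ] (Fin (M + K) → ℝ) →ₗ[ℝ] (Fin (M + K) → ℝ)}
    (hb : ∀ i j k : Fin (M + K), 0 ≤ b (Pi.single j 1) (Pi.single k 1) i)
    {y y' : Fin K → ℝ} (hyy' : y ≤ y') (i j : Fin M) :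
    Tmat M K b y' i j ≤ Tmat M K b y i j := by
  have hQ : 0 ≤ (Qmat M K)ᵀ *ᵥ (y' - y) :=
    Matrix.mulVec_nonneg_of_entry_nonneg (fun i j => Qmat_nonneg M K j i) (sub_nonneg.2 hyy')
  have hsingle (k : Fin (M + K)) : (0 : Fin (M + K) → ℝ) ≤ Pi.single k 1 :=
    Pi.single_nonneg.2 zero_le_one
  have hconj {A : Matrix (Fin (M + K)) (Fin (M + K)) ℝ} (hA : ∀ i j, 0 ≤ A i j) :
      0 ≤ (Pmat M K * A * (Pmat M K)ᵀ) i j :=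
    Matrix.mul_entry_nonneg (Matrix.mul_entry_nonneg (Pmat_nonneg M K) hA)
      (fun i j => Pmat_nonneg M K j i) i j
  have h : 0 ≤ (Tmat M K b y - Tmat M K b y') i j := by
    rw [Tmat_sub_Tmat]
    refine add_nonneg (hconj fun k l => ?_) (hconj fun k l => ?_) <;>
      rw [LinearMap.toMatrix'_apply]
    · exact LinearMap.apply_apply_nonneg_of_single hb (hsingle l) hQ k
    · exact LinearMap.apply_apply_nonneg_of_single hb hQ (hsingle l) k
  exact sub_nonneg.1 h

/-- monotonicity of `T_y`, `T_y⁻¹`, `a_y` and `b_y` with respect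
to `0 ≤ y ≤ y'`, assuming both `T_y` and `T_{y'}` are invertible with
entrywise nonnegative inverses. -/
theorem stmt_8 {M K : ℕ} (hM : 1 ≤ M) (hK : 1 ≤ K)
    (b : (Fin (M + K) → ℝ) →ₗ[ℝ] (Fin (M + K) → ℝ) →ₗ[ℝ] (Fin (M + K) → ℝ))
    (hb : ∀ i j k : Fin (M + K), 0 ≤ b (Pi.single j 1) (Pi.single k 1) i)
    (a : Fin (M + K) → ℝ) (ha : 0 ≤ a)
    (y y' : Fin K → ℝ) (hy0 : 0 ≤ y) (hyy' : y ≤ y')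
    (hTy : IsUnit (Tmat M K b y)) (hTyInv : ∀ i j, 0 ≤ (Tmat M K b y)⁻¹ i j)
    (hTy' : IsUnit (Tmat M K b y')) (hTy'Inv : ∀ i j, 0 ≤ (Tmat M K b y')⁻¹ i j) :
    (∀ i j, Tmat M K b y' i j ≤ Tmat M K b y i j)
    ∧ (∀ i j, (Tmat M K b y)⁻¹ i j ≤ (Tmat M K b y')⁻¹ i j)
    ∧ aSub M K b a y ≤ aSub M K b a y'
    ∧ ∀ u v : Fin M → ℝ, 0 ≤ u → 0 ≤ v → bSub M K b y u v ≤ bSub M K b y' u v := by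
  have hT := Tmat_antitone hb hyy'
  have hInv := Matrix.inv_entry_le_inv hTy hTy' hTyInv hTy'Inv hT
  have hP {w : Fin (M + K) → ℝ} (hw : 0 ≤ w) : 0 ≤ Pmat M K *ᵥ w :=
    Matrix.mulVec_nonneg_of_entry_nonneg (Pmat_nonneg M K) hw
  have hQ : 0 ≤ (Qmat M K)ᵀ *ᵥ y :=
    Matrix.mulVec_nonneg_of_entry_nonneg (fun i j => Qmat_nonneg M K j i) hy0
  have hQQ : (Qmat M K)ᵀ *ᵥ y ≤ (Qmat M K)ᵀ *ᵥ y' :=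
    Matrix.mulVec_le_mulVec_of_entry_nonneg (fun i j => Qmat_nonneg M K j i)
      (fun _ _ => le_rfl) (hy0.trans hyy') hyy'
  have hQ' := hQ.trans hQQ
  refine ⟨hT, hInv, ?_, fun u v hu hv => ?_⟩
  · have hbnonneg := LinearMap.apply_apply_nonneg_of_single hb hQ' hQ'
    have hbmono : b ((Qmat M K)ᵀ *ᵥ y) ((Qmat M K)ᵀ *ᵥ y)
        ≤ b ((Qmat M K)ᵀ *ᵥ y') ((Qmat M K)ᵀ *ᵥ y') := by
      have h₁ := LinearMap.apply_apply_nonneg_of_single hb (sub_nonneg.2 hQQ) hQ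
      have h₂ := LinearMap.apply_apply_nonneg_of_single hb hQ' (sub_nonneg.2 hQQ)
      rw [map_sub, LinearMap.sub_apply, sub_nonneg] at h₁
      rw [map_sub, sub_nonneg] at h₂
      exact h₁.trans h₂
    exact Matrix.mulVec_le_mulVec_of_entry_nonneg hTyInv hInv (add_nonneg (hP ha) (hP hbnonneg))
      (add_le_add_right (Matrix.mulVec_le_mulVec_of_entry_nonneg (Pmat_nonneg M K)
        (fun _ _ => le_rfl) hbnonneg hbmono) _)
  · have hPt {w : Fin M → ℝ} (hw : 0 ≤ w) : 0 ≤ (Pmat M K)ᵀ *ᵥ w :=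
      Matrix.mulVec_nonneg_of_entry_nonneg (fun i j => Pmat_nonneg M K j i) hw
    exact Matrix.mulVec_le_mulVec_of_entry_nonneg hTyInv hInv
      (hP (LinearMap.apply_apply_nonneg_of_single hb (hPt hu) (hPt hv))) le_rfl
end

section
/- Let b be a nonnegative bilinear map, a = e − b(e,e) ≥ 0, assume R := b(e,·) + b(·,e) is irreducible, and assume the minimal nonnegative solution x* of the QVE x = a + b(x,x) is strictly positive. Let w > 0, and suppose y* ∈ ℝ^N with 0 < y* ≤ e and λ* ∈ ℝ satisfy λ* y* = H_{y*} y* and w^T(y* − H_{y*} y*) = 0, where H_y := b(·,e) + b(e−y,·). Then λ* = 1 and x := e − y* is the minimal nonnegative solution of the QVE, i.e. x = x*. -/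
open Matrix

/-- Irreducibility of a matrix: the directed graph with an edge `i → j`
whenever `A i j ≠ 0` is strongly connected. -/
def Irred {N : ℕ} (A : Matrix (Fin N) (Fin N) ℝ) : Prop :=
  ∀ i j : Fin N, Relation.ReflTransGen (fun p q => A p q ≠ 0) i j

/-- `H_y := b(·,e) + b(e-y,·)`, the matrix of the linear map
`v ↦ b(v,e) + b(e-y,v)`. -/
noncomputable def Hmat {N : ℕ}
    (b : (Fin N → ℝ) →ₗ[ℝ] (Fin N → ℝ) →ₗ[ℝ] (Fin N → ℝ))
    (y : Fin N → ℝ) : Matrix (Fin N) (Fin N) ℝ :=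
  LinearMap.toMatrix' (b.flip (fun _ => 1) + b ((fun _ => 1) - y))

/-- A bilinear map with nonnegative coefficients maps nonnegative vectors to nonnegative vectors. -/
theorem bilinear_apply_nonneg {N : ℕ}
    (b : (Fin N → ℝ) →ₗ[ℝ] (Fin N → ℝ) →ₗ[ℝ] (Fin N → ℝ))
    (hb : ∀ i j k : Fin N, 0 ≤ b (Pi.single j 1) (Pi.single k 1) i)
    {u v : Fin N → ℝ} (hu : 0 ≤ u) (hv : 0 ≤ v) : 0 ≤ b u v := by
  intro i
  have h : b u v = ∑ j, ∑ k, (u j * v k) • b (Pi.single j 1) (Pi.single k 1) := by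
    conv_lhs => rw [pi_eq_sum_univ' u, pi_eq_sum_univ' v]
    simp only [map_sum, map_smul, LinearMap.sum_apply, LinearMap.smul_apply, Finset.smul_sum,
      smul_smul]
    rw [Finset.sum_comm]
    simp only [mul_comm]
  rw [h]
  simp only [Finset.sum_apply, Pi.smul_apply, smul_eq_mul, Pi.zero_apply]
  exact Finset.sum_nonneg fun j _ => Finset.sum_nonneg fun k _ =>
    mul_nonneg (mul_nonneg (hu j) (hv k)) (hb i j k)

/-- if the Perron iteration limit `y*` with `0 < y* ≤ e`
satisfies `λ* y* = H_{y*} y*` and the normalization `wᵀ(y* - H_{y*} y*) = 0`,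
then `λ* = 1` and `e - y*` is the minimal nonnegative solution `x*` of the
QVE. -/
theorem stmt_12 {N : ℕ} (hN : 1 ≤ N)
    (b : (Fin N → ℝ) →ₗ[ℝ] (Fin N → ℝ) →ₗ[ℝ] (Fin N → ℝ))
    (hb : ∀ i j k : Fin N, 0 ≤ b (Pi.single j 1) (Pi.single k 1) i)
    (a : Fin N → ℝ)
    (haDef : a = (fun _ => 1) - b (fun _ => 1) (fun _ => 1))
    (ha : 0 ≤ a)
    (hR : Irred (Matrix.of fun i j : Fin N =>
      ∑ k, (b (Pi.single j 1) (Pi.single k 1) i + b (Pi.single k 1) (Pi.single j 1) i)))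
    (xstar : Fin N → ℝ) (hxstar_pos : ∀ i, 0 < xstar i)
    (hxstar_sol : xstar = a + b xstar xstar)
    (hxstar_min : ∀ xbar : Fin N → ℝ, 0 ≤ xbar → xbar = a + b xbar xbar → xstar ≤ xbar)
    (w : Fin N → ℝ) (hw : ∀ i, 0 < w i)
    (ystar : Fin N → ℝ) (hystar_pos : ∀ i, 0 < ystar i) (hystar_le : ystar ≤ fun _ => 1)
    (lamstar : ℝ)
    (h1 : lamstar • ystar = (Hmat b ystar).mulVec ystar)
    (h2 : w ⬝ᵥ (ystar - (Hmat b ystar).mulVec ystar) = 0) :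
    lamstar = 1 ∧ (fun _ => 1) - ystar = xstar := by
  have key : (Hmat b ystar).mulVec ystar
      = b ystar (fun _ => 1) + b ((fun _ => 1) - ystar) ystar := by
    rw [Hmat, LinearMap.toMatrix'_mulVec]
    rfl
  have hne : (Finset.univ : Finset (Fin N)).Nonempty := ⟨⟨0, hN⟩, Finset.mem_univ _⟩
  have hlam : lamstar = 1 := by
    have hpos : 0 < w ⬝ᵥ ystar :=
      Finset.sum_pos (fun i _ => mul_pos (hw i) (hystar_pos i)) hne
    rw [← h1, dotProduct_sub, dotProduct_smul, smul_eq_mul] at h2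
    have : (1 - lamstar) * (w ⬝ᵥ ystar) = 0 := by linarith
    rcases mul_eq_zero.1 this with h | h <;> linarith
  refine ⟨hlam, ?_⟩
  rw [hlam, one_smul, key] at h1
  set e : Fin N → ℝ := fun _ => 1 with he
  obtain ⟨x, hx⟩ : ∃ x, x = e - ystar := ⟨_, rfl⟩
  have hey : e = x + ystar := by rw [hx]; abel
  rw [← hx] at h1 ⊢
  have hy0 : 0 ≤ ystar := fun i => (hystar_pos i).le
  have hx0 : 0 ≤ x := by rw [hx]; exact sub_nonneg.2 hystar_le
  have hs0 : 0 ≤ xstar := fun i => (hxstar_pos i).le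
  have hsol : x = a + b x x := by
    have h3 : b e e = b ystar e + b x ystar + b x x := by
      conv_lhs => rw [hey]
      rw [hey]
      simp only [map_add, LinearMap.add_apply]
      abel
    rw [haDef, h3, ← h1, hx]
    abel
  have hle : xstar ≤ x := hxstar_min x hx0 hsol
  obtain ⟨d, hd⟩ : ∃ d, d = x - xstar := ⟨_, rfl⟩
  have hd0 : 0 ≤ d := by rw [hd]; exact sub_nonneg.2 hle
  have hdeq : d = b d x + b xstar d := by
    have h4 : d = b x x - b xstar xstar := by
      calc d = (a + b x x) - (a + b xstar xstar) := by rw [← hsol, ← hxstar_sol, hd]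
        _ = _ := by abel
    have h5 : b d x + b xstar d = b x x - b xstar xstar := by
      rw [hd]
      simp only [map_sub, LinearMap.sub_apply]
      abel
    rw [h5, ← h4]
  obtain ⟨i, -, hi⟩ := Finset.exists_max_image Finset.univ (fun i => d i / ystar i) hne
  obtain ⟨m, -, hm⟩ := Finset.exists_max_image Finset.univ (fun i => 1 / ystar i) hne
  obtain ⟨t, ht⟩ : ∃ t, t = d i / ystar i := ⟨_, rfl⟩
  obtain ⟨c, hc⟩ : ∃ c, c = 1 / ystar m := ⟨_, rfl⟩
  have ht0 : 0 ≤ t := ht ▸ div_nonneg (hd0 i) (hy0 i)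
  have hdt : d ≤ t • ystar := fun j => by
    simpa [ht] using (div_le_iff₀ (hystar_pos j)).1 (hi j (Finset.mem_univ j))
  have hec : e ≤ c • ystar := fun j => by
    simpa [hc] using (div_le_iff₀ (hystar_pos j)).1 (hm j (Finset.mem_univ j))
  have hxc : x ≤ c • ystar := (hx ▸ sub_le_self e hy0).trans hec
  have hdi : t * ystar i = d i := by rw [ht]; exact div_mul_cancel₀ _ (hystar_pos i).ne'
  have hpos := @bilinear_apply_nonneg N b hb
  have p1 := hpos (sub_nonneg.2 hdt) hx0 i
  have p2 := hpos hs0 (sub_nonneg.2 hdt) i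
  have p3 := hpos hd0 hy0 i
  have p4 := hpos hy0 (sub_nonneg.2 hec) i
  have p5 := hpos (sub_nonneg.2 hxc) hy0 i
  have q1 := congrFun h1 i
  have q2 := congrFun hdeq i
  have hxs : x = xstar + d := by rw [hd]; abel
  have q3 : b ystar e i = b ystar x i + b ystar ystar i := by rw [hey, map_add]; rfl
  have q4 : b x ystar i = b xstar ystar i + b d ystar i := by
    rw [hxs, map_add]; rfl
  simp only [map_sub, map_smul, LinearMap.sub_apply, LinearMap.smul_apply, Pi.sub_apply,
    Pi.smul_apply, Pi.add_apply, Pi.zero_apply, smul_eq_mul] at p1 p2 p3 p4 p5 q1 q2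
  have hzero : t * b ystar ystar i ≤ 0 := by
    have p3' := mul_nonneg ht0 p3
    have q1' := congrArg (t * ·) q1
    simp only [q3, q4, mul_add] at q1'
    linarith
  have hyi := hystar_pos i
  have hyy : 0 < b ystar ystar i := by
    refine (hpos hy0 hy0 i).lt_of_ne fun h => ?_
    rw [Pi.zero_apply] at h
    rw [← h] at p4 p5
    linarith
  have htz : t ≤ 0 := nonpos_of_mul_nonpos_left hzero hyy
  have hdz : d ≤ 0 := hdt.trans (smul_nonpos_of_nonpos_of_nonneg htz hy0)
  exact sub_eq_zero.1 (hd ▸ le_antisymm hdz hd0)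
end

section
/- Let b be a nonnegative bilinear map and x ∈ ℝ^N with x > 0 componentwise. For all i ≠ j, the (i,j) entry of the matrix b(x,·) + b(·,x) is zero if and only if R_{ij} = 0, where R_{ij} = Σ_k (b_{ijk} + b_{ikj}). Consequently, if R is irreducible, then the matrix b(x,·) + b(·,x) is irreducible, and hence F'_x := I − b(x,·) − b(·,x) has irreducible off-diagonal zero pattern. -/
open Matrix

/-- The off-diagonal zero pattern of a matrix is irreducible: the directed
graph with an edge `i → j` whenever `i ≠ j` and `A i j ≠ 0` is strongly
connected. -/
def OffDiagIrred {N : ℕ} (A : Matrix (Fin N) (Fin N) ℝ) : Prop :=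
  ∀ i j : Fin N, Relation.ReflTransGen (fun p q => p ≠ q ∧ A p q ≠ 0) i j

theorem toMatrix'_add_toMatrix'_flip_apply {N : ℕ}
    (b : (Fin N → ℝ) →ₗ[ℝ] (Fin N → ℝ) →ₗ[ℝ] (Fin N → ℝ)) (x : Fin N → ℝ) (i j : Fin N) :
    (LinearMap.toMatrix' (b x) + LinearMap.toMatrix' (b.flip x)) i j =
      ∑ k, x k * (b (Pi.single j 1) (Pi.single k 1) i + b (Pi.single k 1) (Pi.single j 1) i) := by
  have hx : x = ∑ k, x k • (Pi.single k 1 : Fin N → ℝ) := pi_eq_sum_univ' x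
  rw [Matrix.add_apply, LinearMap.toMatrix'_apply, LinearMap.toMatrix'_apply,
    LinearMap.flip_apply]
  conv_lhs => rw [hx]
  simp only [map_sum, map_smul, LinearMap.sum_apply, LinearMap.smul_apply, Finset.sum_apply,
    Pi.smul_apply, smul_eq_mul, mul_add, Finset.sum_add_distrib]
  exact add_comm _ _

theorem sum_mul_eq_zero_iff_of_pos {ι : Type*} [Fintype ι] {x c : ι → ℝ}
    (hx : ∀ i, 0 < x i) (hc : ∀ i, 0 ≤ c i) : ∑ k, x k * c k = 0 ↔ ∑ k, c k = 0 := by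
  rw [Finset.sum_eq_zero_iff_of_nonneg fun k _ => mul_nonneg (hx k).le (hc k),
    Finset.sum_eq_zero_iff_of_nonneg fun k _ => hc k]
  simp [(hx _).ne']

theorem Irred.offDiagIrred {N : ℕ} {A B : Matrix (Fin N) (Fin N) ℝ} (hA : Irred A)
    (h : ∀ i j, i ≠ j → A i j ≠ 0 → B i j ≠ 0) : OffDiagIrred B := fun i j => by
  induction hA i j with
  | refl => exact .refl
  | @tail p q _ hpq ih =>
    rcases eq_or_ne p q with rfl | hne
    · exact ih
    · exact ih.tail ⟨hne, h p q hne hpq⟩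

theorem OffDiagIrred.irred {N : ℕ} {A : Matrix (Fin N) (Fin N) ℝ} (hA : OffDiagIrred A) :
    Irred A := fun i j => Relation.ReflTransGen.mono (fun _ _ h => h.2) i j (hA i j)

/-- for `x > 0`, the off-diagonal entries of `b(x,·) + b(·,x)`
vanish exactly where those of `R` do; hence if `R` is irreducible then
`b(x,·) + b(·,x)` is irreducible and `F'_x = I - b(x,·) - b(·,x)` has
irreducible off-diagonal zero pattern. -/
theorem stmt_13 {N : ℕ} (hN : 1 ≤ N)
    (b : (Fin N → ℝ) →ₗ[ℝ] (Fin N → ℝ) →ₗ[ℝ] (Fin N → ℝ))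
    (hb : ∀ i j k : Fin N, 0 ≤ b (Pi.single j 1) (Pi.single k 1) i)
    (x : Fin N → ℝ) (hx : ∀ i, 0 < x i) :
    (∀ i j : Fin N, i ≠ j →
      ((LinearMap.toMatrix' (b x) + LinearMap.toMatrix' (b.flip x)) i j = 0
        ↔ ∑ k, (b (Pi.single j 1) (Pi.single k 1) i + b (Pi.single k 1) (Pi.single j 1) i) = 0))
    ∧ (Irred (Matrix.of fun i j : Fin N =>
          ∑ k, (b (Pi.single j 1) (Pi.single k 1) i + b (Pi.single k 1) (Pi.single j 1) i)) →
        Irred (LinearMap.toMatrix' (b x) + LinearMap.toMatrix' (b.flip x))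
        ∧ OffDiagIrred ((1 : Matrix (Fin N) (Fin N) ℝ)
            - LinearMap.toMatrix' (b x) - LinearMap.toMatrix' (b.flip x))) := by
  have key (i j : Fin N) : (LinearMap.toMatrix' (b x) + LinearMap.toMatrix' (b.flip x)) i j = 0 ↔
      ∑ k, (b (Pi.single j 1) (Pi.single k 1) i + b (Pi.single k 1) (Pi.single j 1) i) = 0 := by
    rw [toMatrix'_add_toMatrix'_flip_apply]
    exact sum_mul_eq_zero_iff_of_pos hx fun k => add_nonneg (hb i j k) (hb i k j)
  refine ⟨fun i j _ => key i j, fun hR => ?_⟩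
  have hM : Irred (LinearMap.toMatrix' (b x) + LinearMap.toMatrix' (b.flip x)) :=
    (hR.offDiagIrred fun i j _ h => (key i j).not.mpr h).irred
  refine ⟨hM, hM.offDiagIrred fun i j hij h => ?_⟩
  rw [sub_sub, Matrix.sub_apply, Matrix.one_apply_ne hij, zero_sub]
  exact neg_ne_zero.mpr h
end
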